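/- Define P : 𝔣 × 𝔣 → 𝔣 by P(A,B) := Σ_{p=1}^s ((−1)^{p+1}/p) Σ (1/(k₁!⋯k_p! ℓ₁!⋯ℓ_p! (k₁+ℓ₁+⋯+k_p+ℓ_p))) [A^{k₁}, B^{ℓ₁}, …, A^{k_p}, B^{ℓ_p}], where the inner sum ranges over nonnegative integers k₁,ℓ₁,…,k_p,ℓ_p with kᵢ + ℓᵢ ≥ 1 for each i and k₁+ℓ₁+⋯+k_p+ℓ_p ≤ s, [V₁,…,V_q] denotes the right-nested iterated bracket [V₁,[⋯,[V_{q−1},V_q]⋯]], and A^k stands for k consecutive copies of A. Then (𝔣, ·) with A · B := P(A,B) is a group: P(A,0) = P(0,A) = A, P(A,−A) = P(−A,A) = 0, and P(P(A,B),C) = P(A,P(B,C)) for all A, B, C ∈ 𝔣. Moreover, for each A ∈ 𝔣 the map t ↦ tA is a one-parameter subgroup: P(tA, uA) = (t+u)A for all t, u ∈ ℝ. -/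

import Mathlib

noncomputable section

open MeasureTheory Set Filter Topology

/-- Right-nested iterated bracket `[V₁,[⋯,[V_{q−1},V_q]⋯]]` of a list of elements of a Lie
ring (the bracket of the empty list is `0`, of a singleton `[X]` is `X`). -/
def nestedBr {L : Type*} [LieRing L] : List L → L
  | [] => 0
  | [X] => X
  | X :: Y :: l => ⁅X, nestedBr (Y :: l)⁆

/-- The truncated Baker–Campbell–Hausdorff product
`P(A,B) = Σ_{p=1}^s ((−1)^{p+1}/p) Σ_{kᵢ+ℓᵢ≥1, Σ(kᵢ+ℓᵢ)≤s}
  [A^{k₁},B^{ℓ₁},…,A^{k_p},B^{ℓ_p}] / (k₁!⋯k_p!ℓ₁!⋯ℓ_p!(k₁+ℓ₁+⋯+k_p+ℓ_p))`,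
where `[⋯]` is the right-nested iterated bracket and `A^k` stands for `k` copies of `A`. -/
def bch {L : Type*} [LieRing L] [LieAlgebra ℝ L] (s : ℕ) (A B : L) : L :=
  ∑ p ∈ Finset.Icc 1 s, ((-1 : ℝ) ^ (p + 1) / p) •
    ∑ kl : Fin p → Fin (s + 1) × Fin (s + 1),
      if (∀ i, 1 ≤ ((kl i).1 : ℕ) + ((kl i).2 : ℕ)) ∧
          (∑ i, (((kl i).1 : ℕ) + ((kl i).2 : ℕ))) ≤ s then
        (((∏ i, (Nat.factorial ((kl i).1 : ℕ) * Nat.factorial ((kl i).2 : ℕ))) *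
            (∑ i, (((kl i).1 : ℕ) + ((kl i).2 : ℕ))) : ℕ) : ℝ)⁻¹ •
          nestedBr ((List.ofFn fun i =>
            List.replicate ((kl i).1 : ℕ) A ++ List.replicate ((kl i).2 : ℕ) B).flatten)
      else 0

/-- `F`, with distinguished generators `W`, is (a model of) the free nilpotent Lie algebra of
rank `r` and step `s` over `ℝ`: all brackets of more than `s` elements vanish, `F` is spanned by
the iterated brackets of the generators, and it enjoys the universal property with respect to
`ℝ`-Lie algebras that are nilpotent of step at most `s`. -/
def IsFreeNilpotent {F : Type} [LieRing F] [LieAlgebra ℝ F] (r s : ℕ) (W : Fin r → F) : Prop :=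
  (∀ l : List F, s < l.length → nestedBr l = 0) ∧
  (Submodule.span ℝ {v : F | ∃ L : List (Fin r), L ≠ [] ∧ v = nestedBr (L.map W)} = ⊤) ∧
  (∀ (L' : Type) [LieRing L'] [LieAlgebra ℝ L'],
    (∀ l : List L', s < l.length → nestedBr l = 0) →
    ∀ g : Fin r → L', ∃! f : F →ₗ⁅ℝ⁆ L', ∀ i, f (W i) = g i)
section TruncatedSeries

open Polynomial

/-- The exponential series truncated after degree `n`. -/
noncomputable def truncExp {Q : Type*} [Ring Q] [Algebra ℝ Q] (n : ℕ) (x : Q) : Q :=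
  ∑ i ∈ Finset.range (n + 1), ((i.factorial : ℕ) : ℝ)⁻¹ • x ^ i

/-- The series of `log (1 + x)` truncated after degree `n`. -/
noncomputable def truncLog {Q : Type*} [Ring Q] [Algebra ℝ Q] (n : ℕ) (x : Q) : Q :=
  ∑ p ∈ Finset.range (n + 1), ((-1 : ℝ) ^ (p + 1) / p) • x ^ p

theorem map_truncExp {Q Q' : Type*} [Ring Q] [Algebra ℝ Q] [Ring Q'] [Algebra ℝ Q']
    (f : Q →ₐ[ℝ] Q') (n : ℕ) (x : Q) : f (truncExp n x) = truncExp n (f x) := by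
  simp [truncExp]

theorem map_truncLog {Q Q' : Type*} [Ring Q] [Algebra ℝ Q] [Ring Q'] [Algebra ℝ Q']
    (f : Q →ₐ[ℝ] Q') (n : ℕ) (x : Q) : f (truncLog n x) = truncLog n (f x) := by
  simp [truncLog]

theorem truncExp_zero {Q : Type*} [Ring Q] [Algebra ℝ Q] (n : ℕ) :
    truncExp n (0 : Q) = 1 := by
  simp [truncExp, Finset.sum_range_succ']

theorem truncLog_zero {Q : Type*} [Ring Q] [Algebra ℝ Q] (n : ℕ) :
    truncLog n (0 : Q) = 0 := by
  simp [truncLog, Finset.sum_range_succ']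

theorem truncExp_add_of_commute {Q : Type*} [Ring Q] [Algebra ℝ Q] {n : ℕ} {x y : Q}
    (h : Commute x y) (hx : x ^ (n + 1) = 0) (hy : y ^ (n + 1) = 0)
    (hxy : (x + y) ^ (n + 1) = 0) :
    truncExp n (x + y) = truncExp n x * truncExp n y := by
  let _ : Module ℚ Q := Module.compHom Q (algebraMap ℚ ℝ)
  have key : ∀ z : Q, z ^ (n + 1) = 0 → truncExp n z = IsNilpotent.exp z := by
    intro z hz
    rw [IsNilpotent.exp_eq_sum hz]
    refine Finset.sum_congr rfl fun i _ => ?_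
    rw [← Rat.cast_smul_eq_qsmul ℝ]
    simp
  rw [key _ hx, key _ hy, key _ hxy, IsNilpotent.exp_add_of_commute h ⟨_, hx⟩ ⟨_, hy⟩]

theorem X_pow_succ_dvd_of_dvd_derivative {f : ℝ[X]} {n : ℕ} (h : X ^ n ∣ derivative f)
    (h0 : f.coeff 0 = 0) : X ^ (n + 1) ∣ f := by
  rw [X_pow_dvd_iff] at h ⊢
  intro d hd
  rcases d with _ | d
  · exact h0
  · have := h d (by omega)
    rw [coeff_derivative] at this
    rcases mul_eq_zero.1 this with h | h
    · exact h
    · exact absurd h (by positivity)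

theorem derivative_truncExp (n : ℕ) (f : ℝ[X]) :
    derivative (truncExp (n + 1) f) = derivative f * truncExp n f := by
  rw [truncExp, Finset.sum_range_succ', truncExp, Finset.mul_sum]
  simp only [derivative_add, derivative_sum, derivative_smul, derivative_pow, pow_zero,
    derivative_one, smul_zero, add_zero]
  refine Finset.sum_congr rfl fun i _ => ?_
  rw [Nat.factorial_succ]
  simp only [smul_eq_C_mul, Nat.add_sub_cancel]
  have h1 : (C (((i + 1) * i.factorial : ℕ) : ℝ)⁻¹ : ℝ[X]) * C ((i + 1 : ℕ) : ℝ)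
      = C ((i.factorial : ℕ) : ℝ)⁻¹ := by
    rw [← C_mul]
    congr 1
    have : (i.factorial : ℝ) ≠ 0 := by positivity
    push_cast
    field_simp
  rw [← h1]
  ring

theorem derivative_truncLog (n : ℕ) (f : ℝ[X]) :
    (1 + f) * derivative (truncLog n f) = derivative f * (1 - (-f) ^ n) := by
  have h : derivative (truncLog n f) = derivative f * ∑ i ∈ Finset.range n, (-f) ^ i := by
    rw [truncLog, Finset.sum_range_succ', Finset.mul_sum]
    simp only [derivative_add, derivative_sum, derivative_smul, derivative_pow, pow_zero,
      derivative_one, smul_zero, add_zero]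
    refine Finset.sum_congr rfl fun i _ => ?_
    simp only [smul_eq_C_mul, Nat.add_sub_cancel]
    have h1 : (C ((-1 : ℝ) ^ (i + 1 + 1) / ((i + 1 : ℕ) : ℝ)) : ℝ[X]) * C ((i + 1 : ℕ) : ℝ)
        = (-1) ^ i := by
      rw [← C_mul, div_mul_cancel₀ _ (by positivity)]
      simp [pow_succ]
    rw [neg_pow f i, ← h1]
    ring
  rw [h, ← mul_neg_geom_sum]
  ring

theorem truncLog_truncExp_X (n : ℕ) :
    (X : ℝ[X]) ^ (n + 1) ∣ truncLog n (truncExp n X - 1) - X := by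
  rcases n with _ | n
  · simp [truncLog]
  have hX : (X : ℝ[X]) ∣ truncExp (n + 1) X - 1 := by
    rw [truncExp, Finset.sum_range_succ']
    simp only [pow_zero, Nat.factorial_zero, Nat.cast_one, inv_one, one_smul, add_sub_cancel_right]
    refine Finset.dvd_sum fun i _ => ?_
    rw [smul_eq_C_mul]
    exact Dvd.dvd.mul_left (dvd_pow_self X (Nat.succ_ne_zero i)) _
  set m : ℝ[X] := truncExp (n + 1) X - 1 with hm
  have hm' : derivative m = truncExp n X := by
    rw [hm, derivative_sub, derivative_truncExp]; simp
  have hmm : (1 + m) - derivative m = C (((n+1).factorial : ℕ) : ℝ)⁻¹ * X ^ (n + 1) := by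
    rw [hm', hm, truncExp, Finset.sum_range_succ, truncExp, smul_eq_C_mul]; ring
  have hcop : IsCoprime ((X : ℝ[X]) ^ (n + 1)) (1 + m) := by
    obtain ⟨k, hk⟩ := hX
    refine IsCoprime.pow_left ⟨-k, 1, ?_⟩
    rw [hk]; ring
  refine X_pow_succ_dvd_of_dvd_derivative ?_ ?_
  · refine hcop.dvd_of_dvd_mul_left ?_
    have : (1 + m) * derivative (truncLog (n + 1) m - X)
        = -((1 + m) - derivative m) - derivative m * (-m) ^ (n + 1) := by
      rw [derivative_sub, derivative_X, mul_sub, derivative_truncLog]; ring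
    rw [this, hmm]
    refine dvd_sub ?_ ?_
    · exact (Dvd.intro_left _ rfl).neg_right
    · exact Dvd.dvd.mul_left (pow_dvd_pow_of_dvd hX.neg_right _) _
  · have h0 : m.eval 0 = 0 := by
      obtain ⟨k, hk⟩ := hX
      simp [hk]
    rw [coeff_zero_eq_eval_zero, eval_sub, eval_X, sub_zero]
    have := map_truncLog (aeval (0 : ℝ)) (n + 1) m
    simp only [coe_aeval_eq_eval, h0] at this
    rw [this, truncLog_zero]

theorem truncExp_truncLog_X (n : ℕ) :
    (X : ℝ[X]) ^ (n + 1) ∣ truncExp n (truncLog n X) - (1 + X) := by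
  set l : ℝ[X] := truncLog n X with hl
  have hX : (X : ℝ[X]) ∣ l := by
    rw [hl, truncLog, Finset.sum_range_succ']
    simp only [Nat.cast_zero, div_zero, zero_smul, add_zero]
    refine Finset.dvd_sum fun i _ => ?_
    rw [smul_eq_C_mul]
    exact Dvd.dvd.mul_left (dvd_pow_self X (Nat.succ_ne_zero i)) _
  have h0 : (truncExp n l - (1 + X)).coeff 0 = 0 := by
    have h0 : l.eval 0 = 0 := by
      obtain ⟨k, hk⟩ := hX
      simp [hk]
    rw [coeff_zero_eq_eval_zero, eval_sub]
    have := map_truncExp (aeval (0 : ℝ)) n l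
    simp only [coe_aeval_eq_eval, h0] at this
    rw [this, truncExp_zero]
    simp
  suffices H : ∀ k ≤ n, (X : ℝ[X]) ^ (k + 1) ∣ truncExp n l - (1 + X) from H n le_rfl
  intro k
  induction k with
  | zero => intro _; simpa [X_dvd_iff] using h0
  | succ k ih =>
    intro hk
    refine X_pow_succ_dvd_of_dvd_derivative ?_ h0
    have hcop : IsCoprime ((X : ℝ[X]) ^ (k + 1)) (1 + X) :=
      IsCoprime.pow_left ⟨-1, 1, by ring⟩
    refine hcop.dvd_of_dvd_mul_left ?_
    obtain ⟨n, rfl⟩ : ∃ n', n = n' + 1 := ⟨n - 1, by omega⟩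
    have hlast : truncExp (n + 1) l = truncExp n l
        + C (((n + 1).factorial : ℕ) : ℝ)⁻¹ * l ^ (n + 1) := by
      rw [truncExp, Finset.sum_range_succ, truncExp, smul_eq_C_mul]
    have : (1 + X) * derivative (truncExp (n + 1) l - (1 + X))
        = (truncExp (n + 1) l - (1 + X))
          - C (((n + 1).factorial : ℕ) : ℝ)⁻¹ * l ^ (n + 1)
          - (-X) ^ (n + 1) * truncExp n l := by
      have h2 := derivative_truncLog (n + 1) X
      rw [derivative_X, one_mul] at h2
      rw [derivative_sub, derivative_truncExp, mul_sub, ← mul_assoc, hl, h2, ← hl, hlast]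
      simp
      ring
    rw [this]
    have hXn : (X : ℝ[X]) ^ (k + 1) ∣ X ^ (n + 1) := pow_dvd_pow _ hk
    refine dvd_sub (dvd_sub (ih (by omega)) ?_) ?_
    · exact Dvd.dvd.mul_left (hXn.trans (pow_dvd_pow_of_dvd hX _)) _
    · refine Dvd.dvd.mul_right ?_ _
      rw [neg_pow]
      exact Dvd.dvd.mul_left hXn _

theorem truncLog_truncExp {Q : Type*} [Ring Q] [Algebra ℝ Q] {n : ℕ} {x : Q}
    (hx : x ^ (n + 1) = 0) : truncLog n (truncExp n x - 1) = x := by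
  obtain ⟨k, hk⟩ := truncLog_truncExp_X n
  have := congrArg (aeval x) hk
  simpa [map_truncLog, map_truncExp, hx, sub_eq_zero] using this

theorem truncExp_truncLog {Q : Type*} [Ring Q] [Algebra ℝ Q] {n : ℕ} {x : Q}
    (hx : x ^ (n + 1) = 0) : truncExp n (truncLog n x) = 1 + x := by
  obtain ⟨k, hk⟩ := truncExp_truncLog_X n
  have := congrArg (aeval x) hk
  simpa [map_truncLog, map_truncExp, hx, sub_eq_zero] using this

end TruncatedSeries

section Words

/-- The word `A^{k₁} B^{ℓ₁} ⋯ A^{k_p} B^{ℓ_p}`. -/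
def bchWord {α : Type*} {p n : ℕ} (kl : Fin p → Fin (n + 1) × Fin (n + 1)) (A B : α) : List α :=
  (List.ofFn fun i =>
    List.replicate ((kl i).1 : ℕ) A ++ List.replicate ((kl i).2 : ℕ) B).flatten

theorem length_bchWord {α : Type*} {p n : ℕ} (kl : Fin p → Fin (n + 1) × Fin (n + 1))
    (A B : α) :
    (bchWord kl A B).length = ∑ i, (((kl i).1 : ℕ) + ((kl i).2 : ℕ)) := by
  simp [bchWord, List.length_flatten, List.map_ofFn, List.sum_ofFn, Function.comp_def]

theorem map_bchWord {α β : Type*} {p n : ℕ} (f : α → β)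
    (kl : Fin p → Fin (n + 1) × Fin (n + 1)) (A B : α) :
    (bchWord kl A B).map f = bchWord kl (f A) (f B) := by
  simp [bchWord, List.map_flatten, List.map_ofFn, Function.comp_def]

theorem mem_bchWord {α : Type*} {p n : ℕ} {kl : Fin p → Fin (n + 1) × Fin (n + 1)}
    {A B x : α} (hx : x ∈ bchWord kl A B) : x = A ∨ x = B := by
  simp only [bchWord, List.mem_flatten, List.mem_ofFn] at hx
  obtain ⟨l, ⟨i, rfl⟩, hx⟩ := hx
  simp only [List.mem_append, List.mem_replicate] at hx
  tauto

theorem le_length_bchWord {α : Type*} {p n : ℕ} {kl : Fin p → Fin (n + 1) × Fin (n + 1)}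
    (hkl : ∀ i, 1 ≤ ((kl i).1 : ℕ) + ((kl i).2 : ℕ)) (A B : α) :
    p ≤ (bchWord kl A B).length := by
  rw [length_bchWord]
  simpa using Finset.sum_le_sum (s := Finset.univ) fun i _ => hkl i

theorem map_nestedBr {L L' : Type*} [LieRing L] [LieAlgebra ℝ L] [LieRing L'] [LieAlgebra ℝ L']
    (f : L →ₗ⁅ℝ⁆ L') (l : List L) : f (nestedBr l) = nestedBr (l.map f) := by
  induction l with
  | nil => simp [nestedBr]
  | cons x l ih =>
    cases l with
    | nil => simp [nestedBr]
    | cons y l => simpa [nestedBr] using congrArg (fun z => ⁅f x, z⁆) ih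

theorem nestedBr_cons {L : Type*} [LieRing L] (x : L) {l : List L} (hl : l ≠ []) :
    nestedBr (x :: l) = ⁅x, nestedBr l⁆ := by
  cases l with
  | nil => exact absurd rfl hl
  | cons y l => rfl

theorem map_bch {L L' : Type*} [LieRing L] [LieAlgebra ℝ L] [LieRing L'] [LieAlgebra ℝ L']
    (f : L →ₗ⁅ℝ⁆ L') (s : ℕ) (A B : L) : f (bch s A B) = bch s (f A) (f B) := by
  have h : ∀ (p : ℕ) (kl : Fin p → Fin (s + 1) × Fin (s + 1)),
      f (nestedBr (bchWord kl A B)) = nestedBr (bchWord kl (f A) (f B)) := by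
    intro p kl
    rw [map_nestedBr, map_bchWord]
  simp only [bchWord] at h
  simp only [bch, map_sum, map_smul]
  refine Finset.sum_congr rfl fun p _ => congrArg _ (Finset.sum_congr rfl fun kl _ => ?_)
  split_ifs
  · rw [map_smul, h]
  · simp

/-- If all brackets of more than `s` elements vanish, then the truncation order of the
Baker–Campbell–Hausdorff product does not matter as long as it is at least `s`. -/
theorem bch_eq_of_le {L : Type*} [LieRing L] [LieAlgebra ℝ L] {s n : ℕ} (hsn : s ≤ n)
    (hnil : ∀ l : List L, s < l.length → nestedBr l = 0) (A B : L) :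
    bch n A B = bch s A B := by
  unfold bch
  symm
  refine Finset.sum_subset_zero_on_sdiff (Finset.Icc_subset_Icc_right hsn) ?_ ?_
  · intro p hp
    simp only [Finset.mem_sdiff, Finset.mem_Icc] at hp
    convert smul_zero _
    refine Finset.sum_eq_zero fun kl _ => ?_
    split_ifs with h
    · have := hnil (bchWord kl A B) (lt_of_lt_of_le (by omega) (le_length_bchWord h.1 A B))
      rw [bchWord] at this
      rw [this, smul_zero]
    · rfl
  · intro p _
    congr 1
    refine Finset.sum_of_injOn
      (fun kl i => (Fin.castLE (Nat.succ_le_succ hsn) (kl i).1,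
        Fin.castLE (Nat.succ_le_succ hsn) (kl i).2)) ?_ (by simp) ?_ ?_
    · intro kl _ kl' _ h
      funext i
      have := congrFun h i
      simp only [Prod.mk.injEq, Fin.castLE_inj] at this
      exact Prod.ext this.1 this.2
    · intro kl _ hkl
      split_ifs with h
      · have hs : s < (bchWord kl A B).length := by
          by_contra hlt
          rw [length_bchWord, not_lt] at hlt
          have hi : ∀ i, ((kl i).1 : ℕ) + ((kl i).2 : ℕ) ≤ s := fun i =>
            (Finset.single_le_sum (f := fun i => ((kl i).1 : ℕ) + ((kl i).2 : ℕ))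
              (fun _ _ => Nat.zero_le _) (Finset.mem_univ i)).trans hlt
          refine hkl ⟨fun i => (⟨(kl i).1, by have := hi i; omega⟩,
            ⟨(kl i).2, by have := hi i; omega⟩), by simp, ?_⟩
          funext i
          rfl
        have := hnil _ hs
        rw [bchWord] at this
        rw [this, smul_zero]
      · rfl
    · intro kl _
      simp only [Fin.val_castLE]
      by_cases hc : (∀ i, 1 ≤ ((kl i).1 : ℕ) + ((kl i).2 : ℕ))
      · by_cases hle : (∑ i, (((kl i).1 : ℕ) + ((kl i).2 : ℕ))) ≤ s
        · rw [if_pos ⟨hc, hle⟩, if_pos ⟨hc, hle.trans hsn⟩]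
        · have := hnil (bchWord kl A B) (by rw [length_bchWord]; omega)
          rw [bchWord] at this
          rw [if_neg (fun h => hle h.2), this, smul_zero, ite_self]
      · rw [if_neg (fun h => hc h.1), if_neg (fun h => hc h.1)]

theorem sum_pow_eq_sum_prod_ofFn {ι Q : Type*} [Fintype ι] [Semiring Q] (f : ι → Q) (p : ℕ) :
    (∑ x, f x) ^ p = ∑ kl : Fin p → ι, (List.ofFn fun i => f (kl i)).prod := by
  induction p with
  | zero => simp
  | succ p ih =>
    rw [pow_succ', ih, Finset.sum_mul_sum, ← Fintype.sum_prod_type',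
      ← (Fin.consEquiv fun _ : Fin (p + 1) => ι).sum_comp]
    refine Finset.sum_congr rfl fun x _ => ?_
    simp [Fin.consEquiv, List.ofFn_succ]

theorem prod_ofFn_smul {Q : Type*} [Ring Q] [Algebra ℝ Q] {p : ℕ} (c : Fin p → ℝ)
    (q : Fin p → Q) :
    (List.ofFn fun i => c i • q i).prod = (∏ i, c i) • (List.ofFn q).prod := by
  induction p with
  | zero => simp
  | succ p ih => simp [List.ofFn_succ, Fin.prod_univ_succ, ih, smul_smul, mul_comm]

theorem truncExp_mul_truncExp_sub_one {Q : Type*} [Ring Q] [Algebra ℝ Q] (n : ℕ) (x y : Q) :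
    truncExp n x * truncExp n y - 1 = ∑ k : Fin (n + 1) × Fin (n + 1),
      (if 1 ≤ (k.1 : ℕ) + (k.2 : ℕ) then
        ((Nat.factorial (k.1 : ℕ) * Nat.factorial (k.2 : ℕ) : ℕ) : ℝ)⁻¹ else 0) •
        (x ^ (k.1 : ℕ) * y ^ (k.2 : ℕ)) := by
  have h : truncExp n x * truncExp n y = ∑ k : Fin (n + 1) × Fin (n + 1),
      ((Nat.factorial (k.1 : ℕ) * Nat.factorial (k.2 : ℕ) : ℕ) : ℝ)⁻¹ •
        (x ^ (k.1 : ℕ) * y ^ (k.2 : ℕ)) := by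
    rw [truncExp, truncExp, Finset.sum_range, Finset.sum_range, Finset.sum_mul_sum,
      ← Fintype.sum_prod_type']
    refine Finset.sum_congr rfl fun k _ => ?_
    rw [smul_mul_smul_comm, Nat.cast_mul, mul_inv]
  have h1 : (1 : Q) = ∑ k : Fin (n + 1) × Fin (n + 1), if k = (0, 0) then 1 else 0 := by simp
  rw [h, h1, ← Finset.sum_sub_distrib]
  refine Finset.sum_congr rfl fun k _ => ?_
  by_cases hk : k = (0, 0)
  · simp [hk]
  · have : 1 ≤ (k.1 : ℕ) + (k.2 : ℕ) := by
      by_contra hlt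
      refine hk (Prod.ext (Fin.ext ?_) (Fin.ext ?_)) <;> change (_ : ℕ) = 0 <;> omega
    simp [hk, this]

theorem pow_truncExp_mul_truncExp_sub_one {Q : Type*} [Ring Q] [Algebra ℝ Q] (n p : ℕ)
    (x y : Q) :
    (truncExp n x * truncExp n y - 1) ^ p = ∑ kl : Fin p → Fin (n + 1) × Fin (n + 1),
      if ∀ i, 1 ≤ ((kl i).1 : ℕ) + ((kl i).2 : ℕ) then
        ((∏ i, (Nat.factorial ((kl i).1 : ℕ) * Nat.factorial ((kl i).2 : ℕ)) : ℕ) : ℝ)⁻¹ •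
          (bchWord kl x y).prod
      else 0 := by
  rw [truncExp_mul_truncExp_sub_one, sum_pow_eq_sum_prod_ofFn]
  refine Finset.sum_congr rfl fun kl _ => ?_
  rw [prod_ofFn_smul]
  have hw : (List.ofFn fun i => x ^ ((kl i).1 : ℕ) * y ^ ((kl i).2 : ℕ)).prod
      = (bchWord kl x y).prod := by
    simp [bchWord, List.prod_flatten, List.map_ofFn, Function.comp_def]
  rw [hw, Finset.prod_ite_zero]
  simp only [Finset.mem_univ, true_implies, ite_smul, zero_smul, Nat.cast_prod,
    Finset.prod_inv_distrib]

end Words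

section Associative

attribute [local instance] LieRing.ofAssociativeRing

theorem nestedBr_mem_pow {Q : Type*} [Ring Q] [Algebra ℝ Q] (V : Submodule ℝ Q) {l : List Q}
    (hl : ∀ x ∈ l, x ∈ V) (hne : l ≠ []) : nestedBr l ∈ V ^ l.length := by
  induction l with
  | nil => exact absurd rfl hne
  | cons x l ih =>
    cases l with
    | nil => simpa [nestedBr] using hl x (by simp)
    | cons y l =>
      have h1 := ih (fun z hz => hl z (List.mem_cons_of_mem _ hz)) (by simp)
      have hx : x ∈ V := hl x (by simp)
      rw [nestedBr_cons _ (by simp), Ring.lie_def]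
      refine Submodule.sub_mem _ ?_ ?_
      · rw [List.length_cons, pow_succ']
        exact Submodule.mul_mem_mul hx h1
      · rw [List.length_cons, pow_succ]
        exact Submodule.mul_mem_mul h1 hx

theorem pow_eq_bot_of_le {Q : Type*} [Ring Q] [Algebra ℝ Q] {V : Submodule ℝ Q} {m n : ℕ}
    (hV : V ^ m = ⊥) (hmn : m ≤ n) : V ^ n = ⊥ :=
  pow_eq_zero_of_le hmn hV

theorem nestedBr_eq_zero {Q : Type*} [Ring Q] [Algebra ℝ Q] {V : Submodule ℝ Q} {s : ℕ}
    (hV : V ^ (s + 1) = ⊥) {l : List Q} (hl : ∀ x ∈ l, x ∈ V) (hs : s < l.length) :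
    nestedBr l = 0 := by
  have := nestedBr_mem_pow V hl (by rintro rfl; simp at hs)
  rwa [pow_eq_bot_of_le hV hs, Submodule.mem_bot] at this

theorem list_prod_eq_zero {Q : Type*} [Ring Q] [Algebra ℝ Q] {V : Submodule ℝ Q} {s : ℕ}
    (hV : V ^ (s + 1) = ⊥) {l : List Q} (hl : ∀ x ∈ l, x ∈ V) (hs : s < l.length) :
    l.prod = 0 := by
  have : ∀ l : List Q, (∀ x ∈ l, x ∈ V) → l.prod ∈ V ^ l.length := by
    intro l
    induction l with
    | nil => intro _; simpa using ⟨1, map_one (algebraMap ℝ Q)⟩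
    | cons x l ih =>
      intro hl
      rw [List.prod_cons, List.length_cons, pow_succ']
      exact Submodule.mul_mem_mul (hl x (by simp)) (ih fun z hz => hl z (List.mem_cons_of_mem _ hz))
  have := this l hl
  rwa [pow_eq_bot_of_le hV hs, Submodule.mem_bot] at this

theorem pow_succ_eq_zero_of_mem {Q : Type*} [Ring Q] [Algebra ℝ Q] {V : Submodule ℝ Q} {s : ℕ}
    (hV : V ^ (s + 1) = ⊥) {x : Q} (hx : x ∈ V) : x ^ (s + 1) = 0 := by
  have := Submodule.pow_mem_pow V hx (s + 1)
  rwa [hV, Submodule.mem_bot] at this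

theorem pow_truncExp_mul_truncExp_sub_one_eq_zero {Q : Type*} [Ring Q] [Algebra ℝ Q]
    {V : Submodule ℝ Q} {s : ℕ} (hV : V ^ (s + 1) = ⊥) {A B : Q} (hA : A ∈ V) (hB : B ∈ V)
    (n : ℕ) : (truncExp n A * truncExp n B - 1) ^ (s + 1) = 0 := by
  rw [pow_truncExp_mul_truncExp_sub_one]
  refine Finset.sum_eq_zero fun kl _ => ?_
  split_ifs with h
  · rw [list_prod_eq_zero hV _ (le_length_bchWord h A B), smul_zero]
    intro x hx
    rcases mem_bchWord hx with rfl | rfl <;> assumption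
  · rfl

theorem nestedBr_eq_neg_prod_ad {Q : Type*} [Ring Q] [Algebra ℝ Q] {D : Q} {l : List Q}
    (hl : ∀ x ∈ l, ⁅D, x⁆ = x) (hne : l ≠ []) :
    nestedBr l = -(l.map (LieAlgebra.ad ℝ Q)).prod D := by
  induction l with
  | nil => exact absurd rfl hne
  | cons x l ih =>
    cases l with
    | nil =>
      have := hl x (by simp)
      rw [← lie_skew] at this
      simpa [nestedBr] using this.symm
    | cons y l =>
      rw [nestedBr_cons _ (by simp), ih (fun z hz => hl z (List.mem_cons_of_mem _ hz)) (by simp),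
        List.map_cons (l := y :: l), List.prod_cons, Module.End.mul_apply, LieAlgebra.ad_apply,
        lie_neg]

theorem lie_nestedBr {Q : Type*} [Ring Q] [Algebra ℝ Q] {D : Q} {l : List Q}
    (hl : ∀ x ∈ l, ⁅D, x⁆ = x) : ⁅D, nestedBr l⁆ = (l.length : ℝ) • nestedBr l := by
  induction l with
  | nil => simp [nestedBr]
  | cons x l ih =>
    cases l with
    | nil => simpa [nestedBr] using hl x (by simp)
    | cons y l =>
      have h1 := ih (fun z hz => hl z (List.mem_cons_of_mem _ hz))
      rw [nestedBr_cons _ (by simp), leibniz_lie, hl x (by simp), h1, lie_smul,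
        List.length_cons (a := x)]
      push_cast
      rw [add_smul, one_smul, add_comm]

theorem truncExp_mul_truncExp_neg {Q : Type*} [Ring Q] [Algebra ℝ Q] {n : ℕ} {x : Q}
    (hx : x ^ (n + 1) = 0) : truncExp n x * truncExp n (-x) = 1 := by
  rw [← truncExp_add_of_commute (Commute.neg_right rfl) hx (by rw [neg_pow, hx, mul_zero])
    (by simp), add_neg_cancel, truncExp_zero]

theorem ad_pow_eq_zero {Q : Type*} [Ring Q] [Algebra ℝ Q] {s n : ℕ} (hn : 2 * s ≤ n) {x : Q}
    (hx : x ^ (s + 1) = 0) : (LieAlgebra.ad ℝ Q x) ^ (n + 1) = 0 := by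
  rw [LieAlgebra.ad_eq_lmul_left_sub_lmul_right, Pi.sub_apply]
  have hc := LinearMap.commute_mulLeft_right (R := ℝ) x x
  have h1 : (LinearMap.mulLeft ℝ x) ^ (s + 1) = 0 := by
    rw [LinearMap.pow_mulLeft, hx, LinearMap.mulLeft_zero_eq_zero]
  have h2 : (-LinearMap.mulRight ℝ x) ^ (s + 1) = 0 := by
    rw [neg_pow, LinearMap.pow_mulRight, hx, LinearMap.mulRight_zero_eq_zero, mul_zero]
  rw [sub_eq_add_neg]
  exact hc.neg_right.add_pow_eq_zero_of_add_le_succ_of_pow_eq_zero h1 h2 (by omega)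

theorem truncExp_ad {Q : Type*} [Ring Q] [Algebra ℝ Q] {s n : ℕ} (hn : 2 * s ≤ n) {x : Q}
    (hx : x ^ (s + 1) = 0) (y : Q) :
    truncExp n (LieAlgebra.ad ℝ Q x) y = truncExp n x * y * truncExp n (-x) := by
  have h0 := ad_pow_eq_zero hn hx
  rw [LieAlgebra.ad_eq_lmul_left_sub_lmul_right, Pi.sub_apply, sub_eq_add_neg] at h0 ⊢
  have hc := LinearMap.commute_mulLeft_right (R := ℝ) x x
  have hx' : x ^ (n + 1) = 0 := pow_eq_zero_of_le (by omega) hx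
  have h1 : (LinearMap.mulLeft ℝ x) ^ (n + 1) = 0 := by
    rw [LinearMap.pow_mulLeft, hx', LinearMap.mulLeft_zero_eq_zero]
  have h2 : (-LinearMap.mulRight ℝ x) ^ (n + 1) = 0 := by
    rw [neg_pow, LinearMap.pow_mulRight, hx', LinearMap.mulRight_zero_eq_zero, mul_zero]
  rw [truncExp_add_of_commute hc.neg_right h1 h2 h0]
  have hL : truncExp n (LinearMap.mulLeft ℝ x) = LinearMap.mulLeft ℝ (truncExp n x) :=
    (map_truncExp (Algebra.lmul ℝ Q) n x).symm
  have hR : truncExp n (-LinearMap.mulRight ℝ x) = LinearMap.mulRight ℝ (truncExp n (-x)) := by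
    have : -LinearMap.mulRight ℝ x = LinearMap.mulRight ℝ (-x) := by ext; simp
    rw [this]
    ext z
    simp [truncExp, LinearMap.pow_mulRight, Finset.mul_sum, LinearMap.sum_apply]
  rw [hL, hR]
  simp [mul_assoc]

/-- Dynkin's formula, in the infinitesimal form given by an element `D` that acts as the degree
derivation on `A` and `B`. -/
theorem lie_bch_eq_neg_truncLog {Q : Type*} [Ring Q] [Algebra ℝ Q] {n : ℕ} {D A B : Q}
    {V : Submodule ℝ Q} (hV : V ^ (n + 1) = ⊥) (hA : A ∈ V) (hB : B ∈ V)
    (hDA : ⁅D, A⁆ = A) (hDB : ⁅D, B⁆ = B) :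
    ⁅D, bch n A B⁆ = -truncLog n (truncExp n (LieAlgebra.ad ℝ Q A) *
      truncExp n (LieAlgebra.ad ℝ Q B) - 1) D := by
  have hmem : ∀ {p : ℕ} (kl : Fin p → Fin (n + 1) × Fin (n + 1)), ∀ x ∈ bchWord kl A B,
      x ∈ V ∧ ⁅D, x⁆ = x := by
    intro p kl x hx
    rcases mem_bchWord hx with rfl | rfl <;> exact ⟨by assumption, by assumption⟩
  have hIcc : Finset.Icc 1 n = Finset.Ico 1 (n + 1) := by
    ext
    simp
  rw [truncLog, Finset.sum_range_succ', bch, hIcc, Finset.sum_Ico_eq_sum_range]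
  simp only [Nat.cast_zero, div_zero, zero_smul, add_zero, LinearMap.sum_apply,
    LinearMap.smul_apply, lie_sum, lie_smul, ← Finset.sum_neg_distrib]
  refine Finset.sum_congr (by simp) fun p _ => ?_
  rw [add_comm 1 p, ← smul_neg, pow_truncExp_mul_truncExp_sub_one]
  congr 1
  rw [LinearMap.sum_apply, ← Finset.sum_neg_distrib]
  refine Finset.sum_congr rfl fun kl _ => ?_
  change ⁅D, ite _ (_ • nestedBr (bchWord kl A B)) _⁆ = _
  by_cases hc : ∀ i, 1 ≤ ((kl i).1 : ℕ) + ((kl i).2 : ℕ)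
  · have hlen := le_length_bchWord hc A B
    have hne : bchWord kl A B ≠ [] := by
      rintro h
      rw [h] at hlen
      simp at hlen
    rw [if_pos hc, LinearMap.smul_apply, ← map_bchWord (LieAlgebra.ad ℝ Q) kl A B, ← smul_neg,
      ← nestedBr_eq_neg_prod_ad (fun x hx => (hmem kl x hx).2) hne]
    by_cases hle : (∑ i, (((kl i).1 : ℕ) + ((kl i).2 : ℕ))) ≤ n
    · rw [if_pos ⟨hc, hle⟩, lie_smul, lie_nestedBr fun x hx => (hmem kl x hx).2, smul_smul,
        length_bchWord, Nat.cast_mul, mul_inv, mul_assoc, inv_mul_cancel₀, mul_one]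
      rw [← length_bchWord kl A B]
      exact_mod_cast (by omega : (bchWord kl A B).length ≠ 0)
    · rw [if_neg fun h => hle h.2, lie_zero,
        nestedBr_eq_zero hV (fun x hx => (hmem kl x hx).1) (by rw [length_bchWord]; omega),
        smul_zero]
  · rw [if_neg hc, if_neg fun h => hc h.1]
    simp

theorem truncLog_pow_eq_zero {Q : Type*} [Ring Q] [Algebra ℝ Q] {m : ℕ} {h : Q}
    (hh : h ^ m = 0) (n : ℕ) : (truncLog n h) ^ m = 0 := by
  obtain ⟨k, hk⟩ : (Polynomial.X : Polynomial ℝ) ∣ truncLog n Polynomial.X := by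
    rw [truncLog, Finset.sum_range_succ']
    simp only [Nat.cast_zero, div_zero, zero_smul, add_zero]
    refine Finset.dvd_sum fun i _ => ?_
    rw [Polynomial.smul_eq_C_mul]
    exact Dvd.dvd.mul_left (dvd_pow_self _ (Nat.succ_ne_zero i)) _
  have h1 := congrArg (Polynomial.aeval h) (congrArg (· ^ m) hk)
  simpa [map_truncLog, mul_pow, hh] using h1

theorem lie_bch_eq_lie_truncLog {Q : Type*} [Ring Q] [Algebra ℝ Q] {s n : ℕ} (hn : 2 * s ≤ n)
    {D A B : Q} {V : Submodule ℝ Q} (hV : V ^ (s + 1) = ⊥) (hA : A ∈ V) (hB : B ∈ V)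
    (hDA : ⁅D, A⁆ = A) (hDB : ⁅D, B⁆ = B) :
    ⁅D, bch n A B⁆ = ⁅D, truncLog n (truncExp n A * truncExp n B - 1)⁆ := by
  have hh := pow_truncExp_mul_truncExp_sub_one_eq_zero hV hA hB n
  have hA' := pow_succ_eq_zero_of_mem hV hA
  have hB' := pow_succ_eq_zero_of_mem hV hB
  have up : ∀ {x : Q}, x ^ (s + 1) = 0 → x ^ (n + 1) = 0 := fun h =>
    pow_eq_zero_of_le (by omega) h
  have neg : ∀ {x : Q}, x ^ (s + 1) = 0 → (-x) ^ (s + 1) = 0 := fun h => by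
    rw [neg_pow, h, mul_zero]
  set W := truncLog n (truncExp n A * truncExp n B - 1) with hW
  have hW' : W ^ (s + 1) = 0 := truncLog_pow_eq_zero hh n
  have hexp : truncExp n W = truncExp n A * truncExp n B := by
    rw [hW, truncExp_truncLog (up hh), add_sub_cancel]
  have hexp' : truncExp n (-W) = truncExp n (-B) * truncExp n (-A) := by
    have h1 : truncExp n (-W) * truncExp n W = 1 := by
      simpa using truncExp_mul_truncExp_neg (up (neg hW'))
    have h2 : truncExp n W * (truncExp n (-B) * truncExp n (-A)) = 1 := by
      rw [hexp, mul_assoc, ← mul_assoc (truncExp n B), truncExp_mul_truncExp_neg (up hB'),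
        one_mul, truncExp_mul_truncExp_neg (up hA')]
    exact left_inv_eq_right_inv h1 h2
  have hAd : truncExp n (LieAlgebra.ad ℝ Q A) * truncExp n (LieAlgebra.ad ℝ Q B)
      = truncExp n (LieAlgebra.ad ℝ Q W) := by
    ext y
    rw [Module.End.mul_apply, truncExp_ad hn hA', truncExp_ad hn hB', truncExp_ad hn hW', hexp,
      hexp']
    simp only [mul_assoc]
  rw [lie_bch_eq_neg_truncLog (pow_eq_bot_of_le hV (by omega)) hA hB hDA hDB, hAd,
    truncLog_truncExp (ad_pow_eq_zero hn hW'), LieAlgebra.ad_apply, lie_skew]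


theorem map_monomial_one_pow_le {Q : Type*} [Ring Q] [Algebra ℝ Q] (V : Submodule ℝ Q) (k : ℕ) :
    (V.map ((Polynomial.monomial (R := Q) 1).restrictScalars ℝ)) ^ k ≤
      (V ^ k).map ((Polynomial.monomial (R := Q) k).restrictScalars ℝ) := by
  induction k with
  | zero =>
    rw [pow_zero, pow_zero, Submodule.one_le]
    exact ⟨1, Submodule.one_le.1 le_rfl, rfl⟩
  | succ k ih =>
    rw [pow_succ, pow_succ]
    refine (mul_le_mul' ih le_rfl).trans (Submodule.mul_le.2 ?_)
    rintro _ ⟨x, hx, rfl⟩ _ ⟨y, hy, rfl⟩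
    refine ⟨x * y, Submodule.mul_mem_mul hx hy, ?_⟩
    simp [Polynomial.monomial_mul_monomial]

/-- The Baker–Campbell–Hausdorff formula in a nilpotent associative algebra. -/
theorem bch_eq_truncLog {Q : Type*} [Ring Q] [Algebra ℝ Q] {s n : ℕ} (hn : 2 * s ≤ n)
    {V : Submodule ℝ Q} (hV : V ^ (s + 1) = ⊥) {a b : Q} (ha : a ∈ V) (hb : b ∈ V) :
    bch n a b = truncLog n (truncExp n a * truncExp n b - 1) := by
  let D : Module.End ℝ (Polynomial Q) := LinearMap.mulLeft ℝ Polynomial.X ∘ₗ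
    (Polynomial.derivative (R := Q)).restrictScalars ℝ
  let f : Polynomial Q →ₐ[ℝ] Module.End ℝ (Polynomial Q) := Algebra.lmul ℝ (Polynomial Q)
  let ev : ∀ c : Q, (∀ x, Commute x c) → (Polynomial Q →ₐ[ℝ] Q) := fun c hc =>
    Polynomial.eval₂AlgHom (AlgHom.id ℝ Q) c hc
  have hev : ∀ c hc x, ev c hc (Polynomial.monomial 1 x) = x * c := by
    intro c hc x
    change Polynomial.eval₂ (AlgHom.id ℝ Q : Q →+* Q) c (Polynomial.monomial 1 x) = _
    rw [Polynomial.eval₂_monomial]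
    simp
  have hevC : ∀ c hc x, ev c hc (Polynomial.C x) = x := by
    intro c hc x
    change Polynomial.eval₂ (AlgHom.id ℝ Q : Q →+* Q) c (Polynomial.C x) = _
    rw [Polynomial.eval₂_C]
    simp
  have hD : ∀ p, ⁅D, f p⁆ = f (Polynomial.X * Polynomial.derivative p) := by
    intro p
    rw [Ring.lie_def]
    ext1 q
    simp only [D, f, LinearMap.sub_apply, Module.End.mul_apply, LinearMap.comp_apply,
      LinearMap.mulLeft_apply, LinearMap.restrictScalars_apply, Algebra.coe_lmul_eq_mul,
      LinearMap.mul_apply', Polynomial.derivative_mul]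
    rw [mul_add, ← mul_assoc p, ← Polynomial.X_mul (p := p), mul_assoc, mul_assoc,
      add_sub_cancel_right]
  have hD1 : ∀ x : Q, ⁅D, f (Polynomial.monomial 1 x)⁆ = f (Polynomial.monomial 1 x) := by
    intro x
    rw [hD, Polynomial.derivative_monomial]
    simp [Polynomial.X_mul_C, Polynomial.C_mul_X_eq_monomial]
  let V' := (V.map ((Polynomial.monomial (R := Q) 1).restrictScalars ℝ)).map f.toLinearMap
  have hV' : V' ^ (s + 1) = ⊥ := by
    rw [← Submodule.map_pow, eq_bot_iff]
    refine (Submodule.map_mono (map_monomial_one_pow_le V _)).trans ?_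
    rw [hV]
    simp
  set q := bch n (Polynomial.monomial 1 a) (Polynomial.monomial 1 b) -
    truncLog n (truncExp n (Polynomial.monomial 1 a) * truncExp n (Polynomial.monomial 1 b) - 1)
    with hq
  have hevq : ∀ c hc, ev c hc q =
      bch n (a * c) (b * c) - truncLog n (truncExp n (a * c) * truncExp n (b * c) - 1) := by
    intro c hc
    have h1 := map_bch (ev c hc).toLieHom n (Polynomial.monomial 1 a) (Polynomial.monomial 1 b)
    simp only [AlgHom.coe_toLieHom, hev] at h1
    rw [hq, map_sub, h1]
    simp only [map_truncLog, map_truncExp, map_sub, map_mul, map_one, hev]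
  have hfq : f (Polynomial.X * Polynomial.derivative q) = 0 := by
    have h1 := map_bch f.toLieHom n (Polynomial.monomial 1 a) (Polynomial.monomial 1 b)
    simp only [AlgHom.coe_toLieHom] at h1
    have hmem : ∀ x ∈ V, f (Polynomial.monomial 1 x) ∈ V' := fun x hx =>
      ⟨_, ⟨x, hx, rfl⟩, rfl⟩
    rw [← hD, hq, map_sub, h1, lie_sub,
      lie_bch_eq_lie_truncLog hn hV' (hmem a ha) (hmem b hb) (hD1 a) (hD1 b)]
    simp only [map_truncLog, map_truncExp, map_sub, map_mul, map_one, sub_self]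
  have hXq : Polynomial.X * Polynomial.derivative q = 0 := by
    simpa [f] using LinearMap.congr_fun hfq 1
  have hqC : q = Polynomial.C (q.coeff 0) := by
    ext k
    rcases k with _ | k
    · simp
    · have h1 := congrArg (fun p => Polynomial.coeff p (k + 1)) hXq
      simp only [Polynomial.coeff_X_mul, Polynomial.coeff_derivative, Polynomial.coeff_zero] at h1
      have h2 : ((k + 1 : ℕ) : ℝ) • q.coeff (k + 1) = 0 := by
        rw [Nat.cast_smul_eq_nsmul, nsmul_eq_mul, ← h1, Nat.cast_comm]
        simp
      rw [Polynomial.coeff_C_succ]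
      exact (smul_eq_zero.1 h2).resolve_left (by positivity)
  have h0 := hevq 0 (fun x => Commute.zero_right x)
  have h1 := hevq 1 (fun x => Commute.one_right x)
  have hb0 : bch n (0 : Q) 0 = 0 := by
    simpa using (map_bch (0 : Q →ₗ⁅ℝ⁆ Q) n 0 0).symm
  rw [hqC, hevC] at h0 h1
  rw [h0] at h1
  simp only [mul_zero, mul_one, truncExp_zero, sub_self, truncLog_zero, hb0] at h1
  exact sub_eq_zero.1 h1.symm

theorem truncExp_bch {Q : Type*} [Ring Q] [Algebra ℝ Q] {s n : ℕ} (hn : 2 * s ≤ n)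
    {V : Submodule ℝ Q} (hV : V ^ (s + 1) = ⊥) {a b : Q} (ha : a ∈ V) (hb : b ∈ V) :
    truncExp n (bch n a b) = truncExp n a * truncExp n b := by
  rw [bch_eq_truncLog hn hV ha hb, truncExp_truncLog (pow_eq_zero_of_le (by omega)
    (pow_truncExp_mul_truncExp_sub_one_eq_zero hV ha hb n)), add_sub_cancel]

/-- The group laws for the Baker–Campbell–Hausdorff product on a nilpotent Lie algebra with a
faithful representation by nilpotent elements. -/
theorem bch_group_laws {F Q : Type*} [LieRing F] [LieAlgebra ℝ F] [Ring Q] [Algebra ℝ Q] {s n : ℕ}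
    (hn : 2 * s ≤ n) {V : Submodule ℝ Q} (hV : V ^ (s + 1) = ⊥) (ρ : F →ₗ⁅ℝ⁆ Q)
    (hρ : Function.Injective ρ) (hρV : ∀ x, ρ x ∈ V) :
    (∀ A B C : F, bch n (bch n A B) C = bch n A (bch n B C)) ∧
    (∀ (A : F) (t u : ℝ), bch n (t • A) (u • A) = (t + u) • A) := by
  have hpow : ∀ x, (ρ x) ^ (n + 1) = 0 := fun x =>
    pow_eq_zero_of_le (by omega) (pow_succ_eq_zero_of_mem hV (hρV x))
  have hexp : ∀ A B, truncExp n (ρ (bch n A B)) = truncExp n (ρ A) * truncExp n (ρ B) := by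
    intro A B
    rw [map_bch, truncExp_bch hn hV (hρV A) (hρV B)]
  have hinj : ∀ x y, truncExp n (ρ x) = truncExp n (ρ y) → x = y := by
    intro x y h
    apply hρ
    rw [← truncLog_truncExp (hpow x), h, truncLog_truncExp (hpow y)]
  refine ⟨fun A B C => hinj _ _ ?_, fun A t u => hinj _ _ ?_⟩
  · simp only [hexp, mul_assoc]
  · rw [hexp, ← truncExp_add_of_commute _ (hpow _) (hpow _), ← map_add, add_smul]
    · rw [← map_add]; exact hpow _
    · rw [map_smul, map_smul]
      exact ((Commute.refl (ρ A)).smul_left t).smul_right u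

end Associative


section FreeNilpotent

attribute [local instance] LieRing.ofAssociativeRing

theorem nestedBr_eq_zero_of_toSubmodule_pow_eq_bot {Q : Type*} [Ring Q] [Algebra ℝ Q]
    (K : LieSubalgebra ℝ Q) {s : ℕ} (hK : K.toSubmodule ^ (s + 1) = ⊥) (l : List K)
    (hl : s < l.length) : nestedBr l = 0 := by
  have hmem : ∀ x ∈ l.map K.incl, x ∈ K.toSubmodule := by
    intro x hx
    obtain ⟨y, -, rfl⟩ := List.mem_map.1 hx
    exact y.2
  have h := nestedBr_eq_zero hK hmem (by rwa [List.length_map])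
  rw [← map_nestedBr] at h
  exact Subtype.ext h

theorem exists_lieHom_of_toSubmodule {F Q ι : Type*} [LieRing F] [LieAlgebra ℝ F] [Ring Q]
    [Algebra ℝ Q] (K : LieSubalgebra ℝ Q) (W : ι → F) (g : ι → K)
    (h : ∃! f : F →ₗ⁅ℝ⁆ K, ∀ i, f (W i) = g i) :
    ∃ ρ : F →ₗ⁅ℝ⁆ Q, (∀ i, ρ (W i) = g i) ∧ ∀ x, ρ x ∈ K.toSubmodule := by
  obtain ⟨f, hf, -⟩ := h
  exact ⟨K.incl.comp f, fun i => congrArg Subtype.val (hf i), fun x => (f x).2⟩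

theorem bch_group_laws_of_toSubmodule_pow_eq_bot {F Q : Type*} [LieRing F] [LieAlgebra ℝ F]
    [Ring Q] [Algebra ℝ Q] {s n : ℕ} (hn : 2 * s ≤ n) (K : LieSubalgebra ℝ Q)
    (hK : K.toSubmodule ^ (s + 1) = ⊥) (ρ : F →ₗ⁅ℝ⁆ Q) (hρ : Function.Injective ρ)
    (hρK : ∀ x, ρ x ∈ K.toSubmodule) :
    (∀ A B C : F, bch n (bch n A B) C = bch n A (bch n B C)) ∧
    (∀ (A : F) (t u : ℝ), bch n (t • A) (u • A) = (t + u) • A) :=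
  bch_group_laws hn hK ρ hρ hρK

variable {F : Type*} [LieRing F] [LieAlgebra ℝ F]

/-- The endomorphisms of `F × ℝ` of the form `(v, c) ↦ (⁅X, v⁆ + c • U, 0)`. -/
def affineAd (F : Type*) [LieRing F] [LieAlgebra ℝ F] :
    LieSubalgebra ℝ (Module.End ℝ (F × ℝ)) where
  carrier := {f | ∃ X U : F, ∀ v c, f (v, c) = (⁅X, v⁆ + c • U, 0)}
  zero_mem' := ⟨0, 0, fun v c => by simp; rfl⟩
  add_mem' := by
    rintro f g ⟨X, U, hf⟩ ⟨Y, V, hg⟩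
    refine ⟨X + Y, U + V, fun v c => ?_⟩
    rw [LinearMap.add_apply, hf, hg, Prod.mk_add_mk, add_lie, smul_add, add_zero]
    congr 1
    abel
  smul_mem' := by
    rintro r f ⟨X, U, hf⟩
    refine ⟨r • X, r • U, fun v c => ?_⟩
    rw [LinearMap.smul_apply, hf, Prod.smul_mk, smul_add, smul_lie, smul_zero, smul_comm r c U]
  lie_mem' := by
    rintro f g ⟨X, U, hf⟩ ⟨Y, V, hg⟩
    refine ⟨⁅X, Y⁆, ⁅X, V⁆ - ⁅Y, U⁆, fun v c => ?_⟩
    rw [Ring.lie_def, LinearMap.sub_apply, Module.End.mul_apply, Module.End.mul_apply, hf, hg, hf,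
      hg, Prod.mk_sub_mk, lie_add, lie_add, lie_smul, lie_smul, lie_lie, smul_sub, zero_smul,
      zero_smul, sub_zero]
    congr 1
    abel

theorem mem_affineAd {f : Module.End ℝ (F × ℝ)} :
    f ∈ affineAd F ↔ ∃ X U : F, ∀ v c, f (v, c) = (⁅X, v⁆ + c • U, 0) := Iff.rfl

/-- The endomorphism `(v, c) ↦ (⁅X, v⁆ + c • X, 0)` of `F × ℝ`. -/
def affineAdOf (X : F) : affineAd F :=
  ⟨LinearMap.inl ℝ F ℝ ∘ₗ
    (LieAlgebra.ad ℝ F X : F →ₗ[ℝ] F).coprod (LinearMap.toSpanSingleton ℝ F X),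
    X, X, fun v c => by simp⟩

theorem affineAdOf_apply (X v : F) (c : ℝ) :
    (affineAdOf X : Module.End ℝ (F × ℝ)) (v, c) = (⁅X, v⁆ + c • X, 0) := by
  simp [affineAdOf]

/-- The span of the brackets of length `k`, as a subspace of `F × ℝ`. -/
def bracketSpan (F : Type*) [LieRing F] [LieAlgebra ℝ F] (k : ℕ) : Submodule ℝ (F × ℝ) :=
  Submodule.span ℝ {x | ∃ l : List F, l.length = k ∧ x = (nestedBr l, 0)}

theorem apply_mem_bracketSpan_succ {f : Module.End ℝ (F × ℝ)} (hf : f ∈ affineAd F) {k : ℕ}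
    {x : F × ℝ} (hx : x ∈ bracketSpan F (k + 1)) : f x ∈ bracketSpan F (k + 2) := by
  obtain ⟨X, U, hf⟩ := mem_affineAd.1 hf
  refine (Submodule.span_le (p := (bracketSpan F (k + 2)).comap f)).2 ?_ hx
  rintro _ ⟨l, hl, rfl⟩
  refine Submodule.subset_span ⟨X :: l, by simp [hl], ?_⟩
  rw [hf, zero_smul, add_zero, nestedBr_cons X (by rintro rfl; simp at hl)]

theorem apply_mem_bracketSpan_one {f : Module.End ℝ (F × ℝ)} (hf : f ∈ affineAd F)
    (x : F × ℝ) : f x ∈ bracketSpan F 1 := by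
  obtain ⟨X, U, hf⟩ := mem_affineAd.1 hf
  exact Submodule.subset_span ⟨[⁅X, x.1⁆ + x.2 • U], rfl, hf x.1 x.2⟩

theorem apply_mem_bracketSpan_of_mem_pow (k : ℕ) {f : Module.End ℝ (F × ℝ)}
    (hf : f ∈ (affineAd F).toSubmodule ^ (k + 1)) (x : F × ℝ) : f x ∈ bracketSpan F (k + 1) := by
  induction k generalizing f with
  | zero =>
    rw [zero_add, pow_one] at hf
    exact apply_mem_bracketSpan_one hf x
  | succ k ih =>
    rw [pow_succ'] at hf
    induction hf using Submodule.mul_induction_on' with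
    | mem_mul_mem g hg h hh => exact apply_mem_bracketSpan_succ hg (ih hh)
    | add g _ h _ hg hh => exact add_mem hg hh

theorem affineAd_pow_eq_bot {s : ℕ} (hnil : ∀ l : List F, s < l.length → nestedBr l = 0) :
    (affineAd F).toSubmodule ^ (s + 1) = ⊥ := by
  rw [eq_bot_iff]
  intro f hf
  rw [Submodule.mem_bot]
  have h1 : bracketSpan F (s + 1) = ⊥ := by
    rw [bracketSpan, Submodule.span_eq_bot]
    rintro _ ⟨l, hl, rfl⟩
    rw [hnil l (by omega)]
    rfl
  refine LinearMap.ext fun x => ?_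
  have h2 := apply_mem_bracketSpan_of_mem_pow s hf x
  rwa [h1, Submodule.mem_bot] at h2

theorem nestedBr_affineAd_eq_zero {s : ℕ}
    (hnil : ∀ l : List F, s < l.length → nestedBr l = 0) (l : List (affineAd F))
    (hl : s < l.length) : nestedBr l = 0 :=
  nestedBr_eq_zero_of_toSubmodule_pow_eq_bot _ (affineAd_pow_eq_bot hnil) l hl

variable {ι : Type*} {W : ι → F}

theorem map_nestedBr_apply (ρ : F →ₗ⁅ℝ⁆ Module.End ℝ (F × ℝ))
    (hρ : ∀ i v c, ρ (W i) (v, c) = (⁅W i, v⁆ + c • W i, 0)) {L : List ι} (hL : L ≠ [])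
    (v : F) (c : ℝ) : ρ (nestedBr (L.map W)) (v, c) =
      (⁅nestedBr (L.map W), v⁆ + c • (L.length : ℝ) • nestedBr (L.map W), 0) := by
  induction L generalizing v c with
  | nil => exact absurd rfl hL
  | cons i L ih =>
    rcases eq_or_ne L [] with rfl | hL'
    · simp [nestedBr, hρ]
    · rw [List.map_cons, nestedBr_cons _ (by simpa using hL'), LieHom.map_lie, Ring.lie_def,
        LinearMap.sub_apply, Module.End.mul_apply, Module.End.mul_apply, ih hL', hρ, hρ, ih hL',
        Prod.mk_sub_mk, lie_lie, List.length_cons]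
      set N := nestedBr (L.map W)
      rw [zero_smul, zero_smul, lie_add, lie_add, lie_smul, lie_smul, lie_smul,
        ← lie_skew N (W i), Nat.cast_succ, add_smul, smul_add, one_smul, smul_neg]
      simp only [add_zero, sub_zero, Prod.mk.injEq, and_true]
      abel

/-- A representation that extends `W i ↦ affineAdOf (W i)` is injective: on brackets of length `k`
it determines `k` times the bracket. -/
theorem injective_of_apply_generators {s : ℕ}
    (hnil : ∀ l : List F, s < l.length → nestedBr l = 0)
    (hspan : Submodule.span ℝ {v : F | ∃ L : List ι, L ≠ [] ∧ v = nestedBr (L.map W)} = ⊤)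
    (ρ : F →ₗ⁅ℝ⁆ Module.End ℝ (F × ℝ))
    (hρ : ∀ i v c, ρ (W i) (v, c) = (⁅W i, v⁆ + c • W i, 0)) : Function.Injective ρ := by
  let d : Module.End ℝ F := LinearMap.fst ℝ F ℝ ∘ₗ LinearMap.applyₗ ((0, 1) : F × ℝ) ∘ₗ
    (ρ : F →ₗ[ℝ] Module.End ℝ (F × ℝ))
  have hd : ∀ x, d x = (ρ x (0, 1)).1 := fun x => rfl
  let q : Polynomial ℝ := ∏ n ∈ Finset.Icc 1 s, (Polynomial.X - Polynomial.C (n : ℝ))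
  have hq : Polynomial.aeval d q = 0 := by
    refine LinearMap.ext_on hspan ?_
    rintro _ ⟨L, hL, rfl⟩
    rw [LinearMap.zero_apply]
    rcases lt_or_ge s L.length with h | h
    · rw [hnil _ (by simpa using h), map_zero]
    · have hdL : d (nestedBr (L.map W)) = (L.length : ℝ) • nestedBr (L.map W) := by
        rw [hd, map_nestedBr_apply ρ hρ hL]
        simp
      have hLpos : 1 ≤ L.length := List.length_pos_iff.2 hL
      have hmem : L.length ∈ Finset.Icc 1 s := Finset.mem_Icc.2 ⟨hLpos, h⟩
      rw [show q = _ from (Finset.prod_erase_mul _ _ hmem).symm, map_mul, Module.End.mul_apply]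
      rw [map_sub, Polynomial.aeval_X, Polynomial.aeval_C, LinearMap.sub_apply, hdL,
        Module.algebraMap_end_apply, sub_self, map_zero]
  have hq0 : q.coeff 0 ≠ 0 := by
    rw [Polynomial.coeff_zero_eq_eval_zero, Polynomial.eval_prod, Finset.prod_ne_zero_iff]
    intro n hn
    have := (Finset.mem_Icc.1 hn).1
    simp
    omega
  rw [injective_iff_map_eq_zero]
  intro x hx
  have hdx : d x = 0 := by rw [hd, hx]; rfl
  have h1 := LinearMap.congr_fun hq x
  rw [← Polynomial.divX_mul_X_add q, map_add, map_mul, Polynomial.aeval_X, Polynomial.aeval_C,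
    LinearMap.add_apply, Module.End.mul_apply, hdx, map_zero, zero_add,
    Module.algebraMap_end_apply, LinearMap.zero_apply] at h1
  exact (smul_eq_zero.1 h1).resolve_left hq0

theorem IsFreeNilpotent.bch_group_laws {F : Type} [LieRing F] [LieAlgebra ℝ F] {r s : ℕ}
    {W : Fin r → F} (hfree : IsFreeNilpotent r s W) :
    (∀ A B C : F, bch s (bch s A B) C = bch s A (bch s B C)) ∧
    (∀ (A : F) (t u : ℝ), bch s (t • A) (u • A) = (t + u) • A) := by
  obtain ⟨hnil, hspan, huniv⟩ := hfree
  obtain ⟨ρ, hρ, hmem⟩ := exists_lieHom_of_toSubmodule (affineAd F) W (fun i => affineAdOf (W i))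
    (huniv (affineAd F) (nestedBr_affineAd_eq_zero hnil) _)
  have hinj := injective_of_apply_generators hnil hspan ρ fun i v c => by
    rw [hρ, affineAdOf_apply]
  have hlaws := bch_group_laws_of_toSubmodule_pow_eq_bot (n := 2 * s) le_rfl _
    (affineAd_pow_eq_bot hnil) ρ hinj hmem
  simp only [bch_eq_of_le (show s ≤ 2 * s by omega) hnil] at hlaws
  exact hlaws

end FreeNilpotent

/-- Section 4, formula (4.1) and following. Let `𝔣` be the free nilpotent
Lie algebra of rank `r ≥ 2` and step `s ≥ 1`, with generators `W₁,…,W_r`, and let `P = bch s`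
be the truncated Baker–Campbell–Hausdorff product. Then `(𝔣, ·)`, `A · B := P(A,B)`, is a
group: `P(A,0) = P(0,A) = A`, `P(A,−A) = P(−A,A) = 0`, `P(P(A,B),C) = P(A,P(B,C))`; moreover
for each `A ∈ 𝔣` the map `t ↦ tA` is a one-parameter subgroup: `P(tA,uA) = (t+u)A`. -/
theorem statement16 {F : Type} [LieRing F] [LieAlgebra ℝ F] (r s : ℕ) (hr : 2 ≤ r)
    (hs : 1 ≤ s) (W : Fin r → F) (hfree : IsFreeNilpotent r s W) :
    (∀ A : F, bch s A 0 = A ∧ bch s 0 A = A ∧ bch s A (-A) = 0 ∧ bch s (-A) A = 0) ∧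
    (∀ A B C : F, bch s (bch s A B) C = bch s A (bch s B C)) ∧
    (∀ (A : F) (t u : ℝ), bch s (t • A) (u • A) = (t + u) • A) := by
  obtain ⟨hassoc, hadd⟩ := hfree.bch_group_laws
  refine ⟨fun A => ⟨?_, ?_, ?_, ?_⟩, hassoc, hadd⟩
  · simpa using hadd A 1 0
  · simpa using hadd A 0 1
  · simpa using hadd A 1 (-1)
  · simpa using hadd A (-1) 1
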